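/- Conditional moment generating function of a jointly Gaussian scalar (core of Theorem 1): let n ≥ 1, let (X, Z) : Ω → ℝⁿ × ℝ be jointly Gaussian with μ_X := E[X], μ_Z := E[Z], invertible Σ_XX := Cov(X), and c := Cov(X, Z) ∈ ℝⁿ, and let a ∈ ℝ. Define the conditional mean m(X) := μ_Z + ⟨Σ_XX^{-1} c, X − μ_X⟩ and the conditional variance s² := Var(Z) − cᵀ Σ_XX^{-1} c. Then exp(aZ) is integrable and, almost surely, E[ exp(a Z) | σ(X) ] = exp( a · m(X) + (a²/2) · s² ). -/

import Mathlib

open Matrix MeasureTheory ProbabilityTheory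
open scoped NNReal

/-- Covariance of two real random variables. -/
noncomputable def cov {Ω : Type*} [MeasurableSpace Ω] (P : Measure Ω) (X Y : Ω → ℝ) : ℝ :=
  ∫ ω, (X ω - ∫ ω', X ω' ∂P) * (Y ω - ∫ ω', Y ω' ∂P) ∂P

/-- `(X, Z)` is jointly Gaussian: the pushforward of the law under every linear
functional of the coordinates is a (possibly degenerate) one-dimensional Gaussian. -/
def IsJointGaussian {Ω : Type*} [MeasurableSpace Ω] {n : ℕ} (P : Measure Ω)
    (X : Ω → Fin n → ℝ) (Z : Ω → ℝ) : Prop :=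
  ∀ (b : Fin n → ℝ) (a : ℝ), ∃ m : ℝ, ∃ v : ℝ≥0,
    Measure.map (fun ω => (∑ j, b j * X ω j) + a * Z ω) P = gaussianReal m v

lemma IsJointGaussian.hasGaussianLaw {Ω : Type*} [MeasurableSpace Ω] {P : Measure Ω} {n : ℕ}
    {X : Ω → Fin n → ℝ} {Z : Ω → ℝ} (h : IsJointGaussian P X Z)
    (hX : Measurable X) (hZ : Measurable Z) :
    HasGaussianLaw (fun ω => (X ω, Z ω)) P where
  isGaussian_map := by
    refine isGaussian_of_map_eq_gaussianReal fun L => ?_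
    obtain ⟨m, v, hmv⟩ := h (fun j => L (Pi.single j 1, 0)) (L (0, 1))
    refine ⟨m, v, ?_⟩
    rw [← hmv, Measure.map_map (by fun_prop) (by fun_prop)]
    congr 1
    ext ω
    have hdecomp : (X ω, Z ω) =
        ∑ j, X ω j • ((Pi.single j 1, 0) : (Fin n → ℝ) × ℝ) + Z ω • (0, 1) := by
      ext i
      · simp [Prod.fst_sum, Finset.sum_apply, Pi.single_apply]
      · simp [Prod.snd_sum]
    rw [Function.comp_apply, hdecomp]
    simp only [map_add, map_sum, map_smul, smul_eq_mul, mul_comm]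

lemma ProbabilityTheory.HasGaussianLaw.prodMk_sub_sum {Ω ι : Type*} [MeasurableSpace Ω]
    [Fintype ι] {P : Measure Ω} {X : Ω → ι → ℝ} {Z : Ω → ℝ}
    (h : HasGaussianLaw (fun ω => (X ω, Z ω)) P) (β : ι → ℝ) :
    HasGaussianLaw (fun ω => (X ω, Z ω - ∑ j, β j * X ω j)) P := by
  simpa using h.map_fun ((ContinuousLinearMap.fst ℝ (ι → ℝ) ℝ).prod
    (ContinuousLinearMap.snd ℝ (ι → ℝ) ℝ -
      (∑ j, β j • ContinuousLinearMap.proj (R := ℝ) (φ := fun _ : ι => ℝ) j) ∘L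
        ContinuousLinearMap.fst ℝ (ι → ℝ) ℝ))

/-- If `(X, W)` is Gaussian with `X` a finite family of real random variables, then `X` and `W` are
independent as soon as `W` is uncorrelated with every coordinate of `X`. -/
lemma ProbabilityTheory.HasGaussianLaw.indepFun_of_covariance_pi_real {Ω ι : Type*}
    [MeasurableSpace Ω] [Fintype ι] {P : Measure Ω} {X : Ω → ι → ℝ} {W : Ω → ℝ}
    (h : HasGaussianLaw (fun ω => (X ω, W ω)) P)
    (hcov : ∀ i, cov[fun ω => X ω i, W; P] = 0) : IndepFun X W P := by
  have hpi : HasGaussianLaw (fun ω => (fun i => X ω i, fun _ : Unit => W ω)) P :=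
    h.map_fun ((ContinuousLinearMap.fst ℝ (ι → ℝ) ℝ).prod
      (ContinuousLinearMap.pi fun _ : Unit => ContinuousLinearMap.snd ℝ (ι → ℝ) ℝ))
  exact (hpi.indepFun_of_covariance_eval (X := fun i ω => X ω i) (Y := fun _ => W)
    fun i _ => hcov i).comp measurable_id (measurable_pi_apply ())

lemma ProbabilityTheory.HasGaussianLaw.integrable_exp_mul {Ω : Type*} [MeasurableSpace Ω]
    {P : Measure Ω} {Y : Ω → ℝ} (hY : HasGaussianLaw Y P) (a : ℝ) :
    Integrable (fun ω => Real.exp (a * Y ω)) P := by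
  have h := integrable_exp_mul_gaussianReal (μ := P[Y]) (v := Var[Y; P].toNNReal) a
  rw [← hY.map_eq_gaussianReal] at h
  exact h.comp_aemeasurable hY.aemeasurable

lemma ProbabilityTheory.HasGaussianLaw.mgf_eq {Ω : Type*} [MeasurableSpace Ω]
    {P : Measure Ω} {Y : Ω → ℝ} (hY : HasGaussianLaw Y P) (a : ℝ) :
    mgf Y P a = Real.exp (P[Y] * a + Var[Y; P] * a ^ 2 / 2) := by
  rw [mgf_gaussianReal hY.map_eq_gaussianReal, Real.coe_toNNReal _ (variance_nonneg _ _)]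

/-- The conditional moment generating function of `f X + W` given `X`, for `W` independent
of `X`. -/
lemma condExp_exp_mul_add_of_indepFun {Ω E : Type*} {mΩ : MeasurableSpace Ω}
    [mE : MeasurableSpace E] {P : Measure Ω} [IsProbabilityMeasure P]
    {X : Ω → E} {W : Ω → ℝ} {f : E → ℝ}
    (hX : Measurable X) (hW : Measurable W) (hf : Measurable f) (hXW : IndepFun X W P) (a : ℝ)
    (hWint : Integrable (fun ω => Real.exp (a * W ω)) P)
    (hint : Integrable (fun ω => Real.exp (a * (f (X ω) + W ω))) P) :
    P[fun ω => Real.exp (a * (f (X ω) + W ω)) | mE.comap X] =ᵐ[P]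
      fun ω => Real.exp (a * f (X ω)) * mgf W P a := by
  have hmul : (fun ω => Real.exp (a * (f (X ω) + W ω))) =
      (fun ω => Real.exp (a * f (X ω))) * fun ω => Real.exp (a * W ω) := by
    ext ω
    rw [Pi.mul_apply, ← Real.exp_add, mul_add]
  have hfX : StronglyMeasurable[mE.comap X] fun ω => Real.exp (a * f (X ω)) :=
    Measurable.stronglyMeasurable <|
      (by fun_prop : Measurable fun x => Real.exp (a * f x)).comp (comap_measurable X)
  have hexpW : StronglyMeasurable[MeasurableSpace.comap W inferInstance]
      fun ω => Real.exp (a * W ω) :=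
    Measurable.stronglyMeasurable <|
      (by fun_prop : Measurable fun x : ℝ => Real.exp (a * x)).comp (comap_measurable W)
  rw [hmul] at hint ⊢
  filter_upwards [condExp_mul_of_stronglyMeasurable_left hfX hint hWint,
    condExp_indep_eq hW.comap_le hX.comap_le hexpW hXW.symm] with ω h₁ h₂
  rw [h₁, Pi.mul_apply, h₂]
  rfl

/-- The residual of `Z` after subtracting a linear combination of the `X j` whose coefficients solve
the normal equations is uncorrelated with every `X i`. -/
lemma ProbabilityTheory.HasGaussianLaw.covariance_sub_sum_eq_zero {Ω ι : Type*}
    [MeasurableSpace Ω] [Fintype ι] {P : Measure Ω} {X : Ω → ι → ℝ} {Z : Ω → ℝ}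
    (h : HasGaussianLaw (fun ω => (X ω, Z ω)) P) {β : ι → ℝ}
    (hβ : ∀ i, ∑ j, β j * cov[fun ω => X ω i, fun ω => X ω j; P] = cov[fun ω => X ω i, Z; P])
    (i : ι) : cov[fun ω => X ω i, fun ω => Z ω - ∑ j, β j * X ω j; P] = 0 := by
  have := h.isProbabilityMeasure
  have hX (j : ι) : MemLp (fun ω => X ω j) 2 P := (h.fst.eval j).memLp_two
  have hβX (j : ι) : MemLp (fun ω => β j * X ω j) 2 P := (hX j).const_mul _
  rw [covariance_fun_sub_right (hX i) h.snd.memLp_two (memLp_finsetSum _ fun j _ => hβX j),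
    covariance_fun_sum_right hβX (hX i), ← hβ i]
  simp_rw [covariance_const_mul_right, sub_self]

lemma ProbabilityTheory.HasGaussianLaw.variance_sub_sum {Ω ι : Type*}
    [MeasurableSpace Ω] [Fintype ι] {P : Measure Ω} {X : Ω → ι → ℝ} {Z : Ω → ℝ}
    (h : HasGaussianLaw (fun ω => (X ω, Z ω)) P) {β : ι → ℝ}
    (hβ : ∀ i, ∑ j, β j * cov[fun ω => X ω i, fun ω => X ω j; P] = cov[fun ω => X ω i, Z; P]) :
    Var[fun ω => Z ω - ∑ j, β j * X ω j; P] =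
      cov[Z, Z; P] - ∑ j, β j * cov[fun ω => X ω j, Z; P] := by
  have := h.isProbabilityMeasure
  have hZ := h.snd.memLp_two
  have hβX (j : ι) : MemLp (fun ω => β j * X ω j) 2 P := (h.fst.eval j).memLp_two.const_mul _
  have hsum : MemLp (fun ω => ∑ j, β j * X ω j) 2 P := memLp_finsetSum _ fun j _ => hβX j
  have hW := hZ.sub hsum
  change MemLp (fun ω => Z ω - ∑ j, β j * X ω j) 2 P at hW
  rw [← covariance_self hW.aemeasurable, covariance_fun_sub_left hZ hsum hW,
    covariance_fun_sum_left hβX hW]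
  simp_rw [covariance_const_mul_left, h.covariance_sub_sum_eq_zero hβ]
  rw [covariance_fun_sub_right hZ hZ hsum, covariance_fun_sum_right hβX hZ]
  simp [covariance_comm Z, covariance_const_mul_left]

/-- The conditional moment generating function of `Z` given `X`, for `(X, Z)` Gaussian, in terms of
a solution `β` of the normal equations. -/
lemma ProbabilityTheory.HasGaussianLaw.condExp_exp_mul {Ω ι : Type*}
    [MeasurableSpace Ω] [Fintype ι] {P : Measure Ω} {X : Ω → ι → ℝ} {Z : Ω → ℝ}
    (hX : Measurable X) (hZ : Measurable Z)
    (h : HasGaussianLaw (fun ω => (X ω, Z ω)) P) {β : ι → ℝ}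
    (hβ : ∀ i, ∑ j, β j * cov[fun ω => X ω i, fun ω => X ω j; P] = cov[fun ω => X ω i, Z; P])
    (a : ℝ) :
    P[fun ω => Real.exp (a * Z ω) | MeasurableSpace.comap X inferInstance] =ᵐ[P]
      fun ω => Real.exp (a * (P[Z] + ∑ j, β j * (X ω j - ∫ ω', X ω' j ∂P)) +
        a ^ 2 / 2 * (cov[Z, Z; P] - ∑ j, β j * cov[fun ω => X ω j, Z; P])) := by
  have := h.isProbabilityMeasure
  have hβX (j : ι) : Integrable (fun ω => β j * X ω j) P := (h.fst.eval j).integrable.const_mul _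
  have hXW := h.prodMk_sub_sum β
  have hmean : ∫ ω, (Z ω - ∑ j, β j * X ω j) ∂P = P[Z] - ∑ j, β j * ∫ ω, X ω j ∂P := by
    rw [integral_sub h.snd.integrable (integrable_finsetSum _ fun j _ => hβX j),
      integral_finsetSum _ fun j _ => hβX j]
    simp_rw [integral_const_mul]
  have hcond := condExp_exp_mul_add_of_indepFun (f := fun x => ∑ j, β j * x j) hX
    (by fun_prop) (by fun_prop)
    (hXW.indepFun_of_covariance_pi_real (h.covariance_sub_sum_eq_zero hβ)) a
    (hXW.snd.integrable_exp_mul a)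
    (by simpa only [add_sub_cancel] using h.snd.integrable_exp_mul a)
  simp only [add_sub_cancel] at hcond
  refine hcond.trans (.of_forall fun ω => ?_)
  dsimp only
  rw [hXW.snd.mgf_eq, hmean, h.variance_sub_sum hβ, ← Real.exp_add]
  simp only [mul_sub, Finset.sum_sub_distrib]
  congr 1
  ring

theorem stmt12 {Ω : Type*} [MeasurableSpace Ω] (P : Measure Ω) [IsProbabilityMeasure P]
    {n : ℕ} (hn : 1 ≤ n) (X : Ω → Fin n → ℝ) (Z : Ω → ℝ)
    (hmX : Measurable X) (hmZ : Measurable Z)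
    (hGauss : IsJointGaussian P X Z)
    (μX : Fin n → ℝ) (hμX : μX = fun j => ∫ ω, X ω j ∂P)
    (μZ : ℝ) (hμZ : μZ = ∫ ω, Z ω ∂P)
    (SigXX : Matrix (Fin n) (Fin n) ℝ)
    (hSigXX : SigXX = Matrix.of fun i j => cov P (fun ω => X ω i) (fun ω => X ω j))
    (hinv : IsUnit SigXX.det)
    (c : Fin n → ℝ) (hc : c = fun j => cov P (fun ω => X ω j) Z)
    (a : ℝ)
    (m : Ω → ℝ) (hm : m = fun ω => μZ + ∑ j, SigXX⁻¹.mulVec c j * (X ω j - μX j))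
    (s2 : ℝ) (hs2 : s2 = cov P Z Z - c ⬝ᵥ SigXX⁻¹.mulVec c) :
    Integrable (fun ω => Real.exp (a * Z ω)) P ∧
      P[fun ω => Real.exp (a * Z ω) | MeasurableSpace.comap X inferInstance] =ᵐ[P]
        fun ω => Real.exp (a * m ω + a ^ 2 / 2 * s2) := by
  have hXZ := hGauss.hasGaussianLaw hmX hmZ
  refine ⟨hXZ.snd.integrable_exp_mul a, ?_⟩
  have hSigc : SigXX.mulVec (SigXX⁻¹.mulVec c) = c := by
    rw [Matrix.mulVec_mulVec, Matrix.mul_nonsing_inv _ hinv, Matrix.one_mulVec]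
  have hβ (i : Fin n) :
      ∑ j, SigXX⁻¹.mulVec c j * cov[fun ω => X ω i, fun ω => X ω j; P] =
        cov[fun ω => X ω i, Z; P] := by
    calc _ = SigXX.mulVec (SigXX⁻¹.mulVec c) i :=
          Finset.sum_congr rfl fun j _ => by
            rw [mul_comm]
            exact congrArg (· * _) (congrFun₂ hSigXX i j).symm
      _ = c i := congrFun hSigc i
      _ = _ := congrFun hc i
  have hdot : c ⬝ᵥ SigXX⁻¹.mulVec c =
      ∑ j, SigXX⁻¹.mulVec c j * cov[fun ω => X ω j, Z; P] :=
    Finset.sum_congr rfl fun j _ => by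
      rw [mul_comm]
      exact congrArg _ (congrFun hc j)
  rw [hm, hs2, hdot, hμZ, hμX]
  exact hXZ.condExp_exp_mul hmX hmZ hβ a
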